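/- arXiv:1007.2261 — 3 statements merged into one kernel-verified Lean document; each statement's English description precedes it below -/
import Mathlib

section
/- For every integer n ≥ 2 there exists an integer N > 0, depending only on n, such that for every commutative local ring R, every element of SL(n, R) is a product of at most N elementary transvections eᵢⱼ(t) with t ∈ R. -/
/-- The elementary transvection `e i j t = 1 + t·Eᵢⱼ` as an element of `SL(n, R)`. -/
def elemTransvection {n : ℕ} {R : Type*} [CommRing R] (i j : Fin n) (hij : i ≠ j) (t : R) :
    Matrix.SpecialLinearGroup (Fin n) R :=
  ⟨Matrix.transvection i j t, Matrix.det_transvection_of_ne i j hij t⟩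

/-- `g ∈ SL(n, R)` is a product of at most `N` elementary transvections. -/
def IsProductOfElemTransvections {n : ℕ} {R : Type*} [CommRing R]
    (g : Matrix.SpecialLinearGroup (Fin n) R) (N : ℕ) : Prop :=
  ∃ L : List (Matrix.SpecialLinearGroup (Fin n) R),
    L.length ≤ N ∧
    (∀ x ∈ L, ∃ (i j : Fin n) (hij : i ≠ j) (t : R), x = elemTransvection i j hij t) ∧
    L.prod = g

open Matrix

section Transvections

variable {n : ℕ} {R : Type*} [CommRing R]

theorem elemTransvection_mul_elemTransvection_neg {i j : Fin n} (hij : i ≠ j) (t : R) :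
    elemTransvection i j hij t * elemTransvection i j hij (-t) = 1 := by
  apply Subtype.ext
  rw [Matrix.SpecialLinearGroup.coe_mul]
  simp [elemTransvection, transvection_mul_transvection_same _ _ hij]

theorem elemTransvection_neg_mul_elemTransvection {i j : Fin n} (hij : i ≠ j) (t : R) :
    elemTransvection i j hij (-t) * elemTransvection i j hij t = 1 := by
  apply Subtype.ext
  rw [Matrix.SpecialLinearGroup.coe_mul]
  simp [elemTransvection, transvection_mul_transvection_same _ _ hij]

theorem elemTransvection_mul_apply {i j : Fin n} (hij : i ≠ j) (t : R)
    (g : Matrix.SpecialLinearGroup (Fin n) R) (a b : Fin n) :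
    (elemTransvection i j hij t * g) a b = if a = i then g a b + t * g j b else g a b := by
  rw [Matrix.SpecialLinearGroup.coe_mul]
  split_ifs with h
  · subst h
    simp [elemTransvection]
  · simp [elemTransvection, h]

theorem mul_elemTransvection_apply {i j : Fin n} (hij : i ≠ j) (t : R)
    (g : Matrix.SpecialLinearGroup (Fin n) R) (a b : Fin n) :
    (g * elemTransvection i j hij t) a b = if b = j then g a b + t * g a i else g a b := by
  rw [Matrix.SpecialLinearGroup.coe_mul]
  split_ifs with h
  · subst h
    simp [elemTransvection]
  · simp [elemTransvection, h]

namespace IsProductOfElemTransvections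

theorem mono {g : Matrix.SpecialLinearGroup (Fin n) R} {M N : ℕ} (hMN : M ≤ N)
    (hg : IsProductOfElemTransvections g M) : IsProductOfElemTransvections g N := by
  obtain ⟨L, hL, hx, hp⟩ := hg
  exact ⟨L, hL.trans hMN, hx, hp⟩

theorem one (N : ℕ) :
    IsProductOfElemTransvections (1 : Matrix.SpecialLinearGroup (Fin n) R) N :=
  ⟨[], by simp, by simp, by simp⟩

theorem of_elemTransvection_mul {g : Matrix.SpecialLinearGroup (Fin n) R} {N : ℕ} {i j : Fin n}
    (hij : i ≠ j) (t : R)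
    (h : IsProductOfElemTransvections (elemTransvection i j hij t * g) N) :
    IsProductOfElemTransvections g (N + 1) := by
  obtain ⟨L, hL, hx, hp⟩ := h
  refine ⟨elemTransvection i j hij (-t) :: L, by simpa using hL, ?_, ?_⟩
  · intro x hxL
    rcases List.mem_cons.1 hxL with rfl | hxL
    · exact ⟨i, j, hij, -t, rfl⟩
    · exact hx x hxL
  · rw [List.prod_cons, hp, ← mul_assoc, elemTransvection_neg_mul_elemTransvection, one_mul]

theorem of_mul_elemTransvection {g : Matrix.SpecialLinearGroup (Fin n) R} {N : ℕ} {i j : Fin n}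
    (hij : i ≠ j) (t : R)
    (h : IsProductOfElemTransvections (g * elemTransvection i j hij t) N) :
    IsProductOfElemTransvections g (N + 1) := by
  obtain ⟨L, hL, hx, hp⟩ := h
  refine ⟨L ++ [elemTransvection i j hij (-t)], by simpa using hL, ?_, ?_⟩
  · intro x hxL
    rcases List.mem_append.1 hxL with hxL | hxL
    · exact hx x hxL
    · exact ⟨i, j, hij, -t, List.mem_singleton.1 hxL⟩
  · rw [List.prod_append, hp, List.prod_singleton, mul_assoc,
      elemTransvection_mul_elemTransvection_neg, mul_one]

end IsProductOfElemTransvections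

/-- Subtracting multiples of row `k` from the rows indexed by `T` costs `T.card` transvections. -/
theorem exists_sub_mul_row (g : Matrix.SpecialLinearGroup (Fin n) R) (k : Fin n)
    (T : Finset (Fin n)) (hk : k ∉ T) :
    ∃ g' : Matrix.SpecialLinearGroup (Fin n) R,
      (∀ i j, g' i j = if i ∈ T then g i j - g i k * g k j else g i j) ∧
      ∀ N, IsProductOfElemTransvections g' N → IsProductOfElemTransvections g (N + T.card) := by
  induction T using Finset.induction_on with
  | empty => exact ⟨g, by simp, fun N h => h⟩
  | insert a T ha ih =>
    rw [Finset.mem_insert, not_or] at hk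
    obtain ⟨g', hg', hN⟩ := ih hk.2
    refine ⟨elemTransvection a k (Ne.symm hk.1) (-g a k) * g', fun i j => ?_, fun N h => ?_⟩
    · rw [elemTransvection_mul_apply, hg', hg', if_neg hk.2]
      by_cases hi : i = a
      · subst hi
        simp [ha, sub_eq_add_neg]
      · simp [hi]
    · rw [Finset.card_insert_of_notMem ha]
      exact (hN _ (h.of_elemTransvection_mul)).mono (by omega)

/-- Subtracting multiples of column `k` from the columns indexed by `T` costs `T.card`
transvections. -/
theorem exists_sub_mul_col (g : Matrix.SpecialLinearGroup (Fin n) R) (k : Fin n)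
    (T : Finset (Fin n)) (hk : k ∉ T) :
    ∃ g' : Matrix.SpecialLinearGroup (Fin n) R,
      (∀ i j, g' i j = if j ∈ T then g i j - g k j * g i k else g i j) ∧
      ∀ N, IsProductOfElemTransvections g' N → IsProductOfElemTransvections g (N + T.card) := by
  induction T using Finset.induction_on with
  | empty => exact ⟨g, by simp, fun N h => h⟩
  | insert a T ha ih =>
    rw [Finset.mem_insert, not_or] at hk
    obtain ⟨g', hg', hN⟩ := ih hk.2
    refine ⟨g' * elemTransvection k a hk.1 (-g k a), fun i j => ?_, fun N h => ?_⟩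
    · rw [mul_elemTransvection_apply, hg', hg', if_neg hk.2]
      by_cases hj : j = a
      · subst hj
        simp [ha, sub_eq_add_neg]
      · simp [hj]
    · rw [Finset.card_insert_of_notMem ha]
      exact (hN _ (h.of_mul_elemTransvection)).mono (by omega)

/-- `g` agrees with the identity matrix outside the block `S × S`. -/
def IsSupportedOnBlock (S : Finset (Fin n)) (g : Matrix.SpecialLinearGroup (Fin n) R) : Prop :=
  ∀ i j, i ∉ S ∨ j ∉ S → g i j = (1 : Matrix (Fin n) (Fin n) R) i j

namespace IsSupportedOnBlock

theorem eq_one_of_singleton {k : Fin n} {g : Matrix.SpecialLinearGroup (Fin n) R}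
    (hg : IsSupportedOnBlock {k} g) : g = 1 := by
  have hd : (g : Matrix (Fin n) (Fin n) R) = diagonal fun i => g i i := by
    ext i j
    by_cases hij : i = j
    · simp [hij]
    · rw [diagonal_apply_ne _ hij, hg i j, one_apply_ne hij]
      by_contra! h
      simp only [Finset.mem_singleton] at h
      exact hij (h.1.trans h.2.symm)
  have hkk : g k k = 1 := by
    have hdet := g.det_coe
    rw [hd, det_diagonal, Finset.prod_eq_single k] at hdet
    · exact hdet
    · intro i _ hi
      simpa using hg i i (by simp [hi])
    · simp
  refine Matrix.SpecialLinearGroup.ext _ _ fun i j => ?_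
  by_cases h : i = k ∧ j = k
  · simp [h.1, h.2, hkk]
  · rw [Matrix.SpecialLinearGroup.coe_one]
    exact hg i j (by simpa [imp_iff_not_or] using h)

theorem elemTransvection_mul {S : Finset (Fin n)} {g : Matrix.SpecialLinearGroup (Fin n) R}
    (hg : IsSupportedOnBlock S g) {i j : Fin n} (hi : i ∈ S) (hj : j ∈ S) (hij : i ≠ j) (t : R) :
    IsSupportedOnBlock S (elemTransvection i j hij t * g) := by
  intro a b hab
  rw [elemTransvection_mul_apply]
  split_ifs with h
  · subst h
    have hb : b ∉ S := hab.resolve_left (not_not.2 hi)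
    rw [hg a b hab, hg j b (Or.inr hb), one_apply_ne (ne_of_mem_of_not_mem hj hb), mul_zero,
      add_zero]
  · exact hg a b hab

/-- Over a local ring, each column through the block has a unit entry inside the block. -/
theorem exists_isUnit [IsLocalRing R] {S : Finset (Fin n)} {g : Matrix.SpecialLinearGroup (Fin n) R}
    (hg : IsSupportedOnBlock S g) {k : Fin n} (hk : k ∈ S) : ∃ i ∈ S, IsUnit (g i k) := by
  by_contra! h
  have hmem : ∀ i, g i k ∈ IsLocalRing.maximalIdeal R := by
    intro i
    by_cases hi : i ∈ S
    · exact h i hi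
    · rw [hg i k (Or.inl hi), one_apply_ne (ne_of_mem_of_not_mem hk hi).symm]
      exact zero_mem _
  have hsum : ∑ i, g⁻¹ k i * g i k = 1 := by
    rw [← mul_apply, ← Matrix.SpecialLinearGroup.coe_mul, inv_mul_cancel,
      Matrix.SpecialLinearGroup.coe_one, one_apply_eq]
  refine (IsLocalRing.maximalIdeal.isMaximal R).ne_top ((Ideal.eq_top_iff_one _).2 ?_)
  rw [← hsum]
  exact Ideal.sum_mem _ fun i _ => Ideal.mul_mem_left _ _ (hmem i)

/-- Once the pivot at `k` is `1`, clearing its column and row shrinks the block. -/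
theorem exists_clear {S : Finset (Fin n)} {k : Fin n}
    {g : Matrix.SpecialLinearGroup (Fin n) R} (hg : IsSupportedOnBlock (insert k S) g)
    (hkk : g k k = 1) :
    ∃ g' : Matrix.SpecialLinearGroup (Fin n) R, IsSupportedOnBlock S g' ∧
      ∀ N, IsProductOfElemTransvections g' N →
        IsProductOfElemTransvections g (N + 2 * n) := by
  have hkT : k ∉ Finset.univ.erase k := by simp
  have hcard : (Finset.univ.erase k).card ≤ n := by
    simp
  obtain ⟨g₁, hg₁, hN₁⟩ := exists_sub_mul_row g k _ hkT
  obtain ⟨g₂, hg₂, hN₂⟩ := exists_sub_mul_col g₁ k _ hkT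
  refine ⟨g₂, fun i j hij => ?_, fun N h => (hN₁ _ (hN₂ _ h)).mono (by omega)⟩
  rw [hg₂]
  simp only [hg₁, Finset.mem_erase, Finset.mem_univ, and_true]
  by_cases hi : i = k <;> by_cases hj : j = k
  · subst hi hj
    simp [hkk]
  · subst hi
    simp [hj, hkk, one_apply_ne (Ne.symm hj)]
  · subst hj
    simp [hi, hkk]
  · have hij' : i ∉ insert k S ∨ j ∉ insert k S := by simpa [hi, hj] using hij
    have h0 : g i k * g k j = 0 := by
      rcases hij' with h | h
      · rw [hg i k (Or.inl h), one_apply_ne hi, zero_mul]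
      · rw [hg k j (Or.inr h), one_apply_ne (Ne.symm hj), mul_zero]
    simp [hi, hj, hkk, h0, hg i j hij']

/-- Two transvections suffice to create a pivot `1` at `k`, as soon as the block has another
index. -/
theorem exists_pivot [IsLocalRing R] {S : Finset (Fin n)} {g : Matrix.SpecialLinearGroup (Fin n) R}
    (hg : IsSupportedOnBlock S g) {k l : Fin n} (hk : k ∈ S) (hl : l ∈ S) (hlk : l ≠ k) :
    ∃ g' : Matrix.SpecialLinearGroup (Fin n) R, IsSupportedOnBlock S g' ∧ g' k k = 1 ∧
      ∀ N, IsProductOfElemTransvections g' N → IsProductOfElemTransvections g (N + 2) := by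
  have of_isUnit : ∀ {g : Matrix.SpecialLinearGroup (Fin n) R}, IsSupportedOnBlock S g →
      ∀ {i : Fin n}, i ∈ S → i ≠ k → IsUnit (g i k) →
      ∃ g' : Matrix.SpecialLinearGroup (Fin n) R, IsSupportedOnBlock S g' ∧ g' k k = 1 ∧
        ∀ N, IsProductOfElemTransvections g' N →
          IsProductOfElemTransvections g (N + 1) := by
    intro g hg i hi hik hu
    obtain ⟨u, hu⟩ := hu
    refine ⟨_, hg.elemTransvection_mul hk hi hik.symm ((1 - g k k) * ↑u⁻¹), ?_,
      fun N h => h.of_elemTransvection_mul⟩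
    rw [elemTransvection_mul_apply, if_pos rfl, ← hu, mul_assoc, Units.inv_mul]
    ring
  by_cases h : ∃ i ∈ S, i ≠ k ∧ IsUnit (g i k)
  · obtain ⟨i, hi, hik, hu⟩ := h
    obtain ⟨g', h₁, h₂, h₃⟩ := of_isUnit hg hi hik hu
    exact ⟨g', h₁, h₂, fun N hN => (h₃ N hN).mono (by omega)⟩
  · push Not at h
    obtain ⟨i, hi, hu⟩ := hg.exists_isUnit hk
    obtain rfl : i = k := by
      by_contra hik
      exact h i hi hik hu
    have hsum : IsUnit ((elemTransvection l i hlk (1 : R) * g) l i) := by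
      rw [elemTransvection_mul_apply, if_pos rfl, one_mul]
      by_contra hns
      have := Ideal.sub_mem (IsLocalRing.maximalIdeal R) hns (h l hl hlk)
      rw [add_sub_cancel_left] at this
      exact this hu
    obtain ⟨g', h₁, h₂, h₃⟩ := of_isUnit (hg.elemTransvection_mul hl hk hlk 1) hl hlk hsum
    exact ⟨g', h₁, h₂, fun N hN => (h₃ N hN).of_elemTransvection_mul⟩

theorem isProductOfElemTransvections [IsLocalRing R] {S : Finset (Fin n)}
    {g : Matrix.SpecialLinearGroup (Fin n) R} (hg : IsSupportedOnBlock S g) :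
    IsProductOfElemTransvections g (S.card * (2 * n + 2)) := by
  induction S using Finset.induction_on generalizing g with
  | empty =>
    obtain rfl : g = 1 := by
      refine Matrix.SpecialLinearGroup.ext _ _ fun i j => ?_
      rw [Matrix.SpecialLinearGroup.coe_one]
      exact hg i j (by simp)
    exact .one _
  | insert k S hkS ih =>
    rcases S.eq_empty_or_nonempty with rfl | ⟨l, hl⟩
    · rw [insert_empty_eq] at hg
      rw [hg.eq_one_of_singleton]
      exact .one _
    · obtain ⟨g₁, hg₁, hkk, hN₁⟩ := hg.exists_pivot (Finset.mem_insert_self k S)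
        (Finset.mem_insert_of_mem hl) (fun h => hkS (h ▸ hl))
      obtain ⟨g₂, hg₂, hN₂⟩ := hg₁.exists_clear hkk
      rw [Finset.card_insert_of_notMem hkS, add_one_mul]
      exact hN₁ _ (hN₂ _ (ih hg₂))

end IsSupportedOnBlock

end Transvections

/-- For every `n ≥ 2` there exists `N > 0`, depending only on `n`, such
that for every commutative local ring `R`, every element of `SL(n, R)` is a product of at
most `N` elementary transvections. -/
theorem exists_bound_localRing_isProductOfElemTransvections (n : ℕ) (hn : 2 ≤ n) :
    ∃ N : ℕ, 0 < N ∧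
      ∀ (R : Type*) [CommRing R] [IsLocalRing R],
        ∀ g : Matrix.SpecialLinearGroup (Fin n) R,
          IsProductOfElemTransvections g N := by
  refine ⟨n * (2 * n + 2), by positivity, fun R _ _ g => ?_⟩
  have hg : IsSupportedOnBlock Finset.univ g := fun i j h => by simp at h
  simpa using hg.isProductOfElemTransvections
end

section
/- Let R be a commutative local ring and n ≥ 2. Then every element g of SL(n, R) can be written as g = u₁v₁u₂v₂u₃v₃u₄v₄, where each uᵢ ∈ SL(n, R) is upper triangular with all diagonal entries equal to 1 and each vᵢ ∈ SL(n, R) is lower triangular with all diagonal entries equal to 1. -/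
/-- A matrix is upper unitriangular: all diagonal entries are `1` and all entries below the
diagonal are `0`. -/
def IsUpperUnitriangular {n : ℕ} {R : Type*} [CommRing R] (M : Matrix (Fin n) (Fin n) R) :
    Prop :=
  (∀ i, M i i = 1) ∧ ∀ i j : Fin n, j < i → M i j = 0

/-- A matrix is lower unitriangular: all diagonal entries are `1` and all entries above the
diagonal are `0`. -/
def IsLowerUnitriangular {n : ℕ} {R : Type*} [CommRing R] (M : Matrix (Fin n) (Fin n) R) :
    Prop :=
  (∀ i, M i i = 1) ∧ ∀ i j : Fin n, i < j → M i j = 0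

open Matrix

section Bordered

variable {R : Type*} {n : ℕ}

/-- The block matrix with corner `a`, first row `r`, first column `c` and remaining block `M`. -/
def bordered (a : R) (r c : Fin n → R) (M : Matrix (Fin n) (Fin n) R) :
    Matrix (Fin (n + 1)) (Fin (n + 1)) R :=
  Matrix.of (Fin.cons (Fin.cons a r : Fin (n + 1) → R)
    (fun i => (Fin.cons (c i) (M i) : Fin (n + 1) → R)))

@[simp] lemma bordered_zero_zero (a : R) (r c : Fin n → R) (M : Matrix (Fin n) (Fin n) R) :
    bordered a r c M 0 0 = a := rfl

@[simp] lemma bordered_zero_succ (a : R) (r c : Fin n → R) (M : Matrix (Fin n) (Fin n) R)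
    (j : Fin n) : bordered a r c M 0 j.succ = r j := rfl

@[simp] lemma bordered_succ_zero (a : R) (r c : Fin n → R) (M : Matrix (Fin n) (Fin n) R)
    (i : Fin n) : bordered a r c M i.succ 0 = c i := rfl

@[simp] lemma bordered_succ_succ (a : R) (r c : Fin n → R) (M : Matrix (Fin n) (Fin n) R)
    (i j : Fin n) : bordered a r c M i.succ j.succ = M i j := rfl

lemma exists_eq_bordered (g : Matrix (Fin (n + 1)) (Fin (n + 1)) R) :
    ∃ a r c M, g = bordered a r c M := by
  refine ⟨g 0 0, fun j => g 0 j.succ, fun i => g i.succ 0, fun i j => g i.succ j.succ, ?_⟩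
  ext i j
  cases i using Fin.cases <;> cases j using Fin.cases <;> rfl

variable [CommRing R]

lemma bordered_mul (a a' : R) (r r' c c' : Fin n → R) (M M' : Matrix (Fin n) (Fin n) R) :
    bordered a r c M * bordered a' r' c' M' =
      bordered (a * a' + r ⬝ᵥ c') (a • r' + r ᵥ* M') (a' • c + M *ᵥ c')
        (vecMulVec c r' + M * M') := by
  ext i j
  cases i using Fin.cases <;> cases j using Fin.cases <;>
    simp [Matrix.mul_apply, Fin.sum_univ_succ, dotProduct, vecMul, mulVec, vecMulVec_apply,
      mul_comm]

lemma det_bordered_zero_col (r : Fin n → R) (M : Matrix (Fin n) (Fin n) R) :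
    (bordered 1 r 0 M).det = M.det := by
  rw [det_succ_column_zero, Fin.sum_univ_succ]
  simp only [bordered_succ_zero, Pi.zero_apply, mul_zero, zero_mul, Finset.sum_const_zero]
  simp only [Fin.val_zero, pow_zero, bordered_zero_zero, one_mul, add_zero]
  congr 1

lemma isUpperUnitriangular_bordered {M : Matrix (Fin n) (Fin n) R}
    (hM : IsUpperUnitriangular M) (r : Fin n → R) :
    IsUpperUnitriangular (bordered 1 r 0 M) := by
  refine ⟨fun i => ?_, fun i j hij => ?_⟩
  · cases i using Fin.cases <;> simp [hM.1]
  · cases i using Fin.cases <;> cases j using Fin.cases <;> simp_all [hM.2]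

lemma isLowerUnitriangular_bordered {M : Matrix (Fin n) (Fin n) R}
    (hM : IsLowerUnitriangular M) (c : Fin n → R) :
    IsLowerUnitriangular (bordered 1 0 c M) := by
  refine ⟨fun i => ?_, fun i j hij => ?_⟩
  · cases i using Fin.cases <;> simp [hM.1]
  · cases i using Fin.cases <;> cases j using Fin.cases <;> simp_all [hM.2]

lemma isUpperUnitriangular_one : IsUpperUnitriangular (1 : Matrix (Fin n) (Fin n) R) :=
  ⟨fun i => one_apply_eq i, fun _ _ h => one_apply_ne h.ne'⟩

lemma isLowerUnitriangular_one : IsLowerUnitriangular (1 : Matrix (Fin n) (Fin n) R) :=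
  ⟨fun i => one_apply_eq i, fun _ _ h => one_apply_ne h.ne⟩

lemma IsUpperUnitriangular.det_eq_one {M : Matrix (Fin n) (Fin n) R}
    (hM : IsUpperUnitriangular M) : M.det = 1 := by
  rw [det_of_isUpperTriangular (fun i j h => hM.2 i j h)]
  simp [hM.1]

lemma IsLowerUnitriangular.det_eq_one {M : Matrix (Fin n) (Fin n) R}
    (hM : IsLowerUnitriangular M) : M.det = 1 := by
  rw [det_of_isLowerTriangular M (fun i j h => hM.2 i j h)]
  simp [hM.1]

/-- If the corner can be turned into `1` by first adding multiples of the first row to the other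
rows and then adding multiples of the other rows to the first, the matrix reduces to a block of
smaller size. -/
lemma bordered_eq_mul_of_corner {a : R} {r c : Fin n → R} {M : Matrix (Fin n) (Fin n) R}
    {p q : Fin n → R} (h : a + q ⬝ᵥ (c - a • p) = 1) :
    ∃ z s M', bordered a r c M =
      bordered 1 0 p 1 * bordered 1 (-q) 0 1 * bordered 1 0 z 1 * bordered 1 s 0 M' := by
  set z := c - a • p with hz
  set N := M - vecMulVec p r with hN
  set s := r + q ᵥ* N with hs
  have hc : c = z + a • p := by simp [hz]
  have hM : M = N + vecMulVec p r := by simp [hN]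
  have hr : r = s - q ᵥ* N := by simp [hs]
  have ha : a = 1 - q ⬝ᵥ z := by rw [← h]; ring
  refine ⟨z, s, N - vecMulVec z s, ?_⟩
  simp only [bordered_mul]
  congr 1
  · simp [ha, sub_eq_add_neg]
  · ext j
    rw [hr]
    simp [vecMul_sub, vecMul_vecMulVec, add_smul, neg_vecMul]
    ring
  · ext i
    rw [hc, ha]
    simp [add_mulVec, neg_mulVec, vecMulVec_mulVec]
    ring
  · rw [hM, hr]
    ext i j
    simp [add_mul, mul_sub, vecMulVec_mul, vecMulVec_sub, vecMul_vecMulVec,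
      vecMulVec_apply, add_mulVec, neg_mulVec, vecMulVec_mulVec]
    ring

/-- Unitriangular factors of the smaller block can be distributed over the unipotent factors. -/
lemma bordered_unipotent_mul_eq {p q z s : Fin n → R} {l₁ u₁ l₂ u₂ : Matrix (Fin n) (Fin n) R}
    (h : (l₁ * u₁).det = 1) :
    bordered 1 0 p 1 * bordered 1 q 0 1 * bordered 1 0 z 1 * bordered 1 s 0 (l₁ * u₁ * l₂ * u₂) =
      bordered 1 0 p l₁ * bordered 1 (q ᵥ* (l₁ * u₁)) 0 u₁ *
        bordered 1 0 ((l₁ * u₁)⁻¹ *ᵥ z) l₂ * bordered 1 s 0 u₂ := by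
  obtain ⟨w, rfl⟩ : ∃ w, z = (l₁ * u₁) *ᵥ w :=
    ⟨(l₁ * u₁)⁻¹ *ᵥ z, by rw [mulVec_mulVec, mul_nonsing_inv _ (by simp [h]), one_mulVec]⟩
  rw [mulVec_mulVec, nonsing_inv_mul _ (by simp [h]), one_mulVec]
  simp only [bordered_mul]
  congr 1
  · simp [dotProduct_mulVec]
  · simp [dotProduct_mulVec, vecMul_vecMul, Matrix.mul_assoc]
  · simp [add_mul, vecMulVec_mul, add_mulVec, vecMulVec_mulVec]
  · simp [add_mul, vecMulVec_mul, vecMul_vecMul, Matrix.mul_assoc, add_mulVec, vecMulVec_mulVec]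

end Bordered

section IsLocalRing

variable {R : Type*} [CommRing R] [IsLocalRing R] {n : ℕ}

lemma exists_isUnit_col_zero {g : Matrix (Fin (n + 1)) (Fin (n + 1)) R} (hg : g.det = 1) :
    ∃ i, IsUnit (g i 0) := by
  by_contra! h
  have hmem : g.det ∈ IsLocalRing.maximalIdeal R := by
    rw [det_succ_column_zero]
    exact Ideal.sum_mem _ fun i _ =>
      Ideal.mul_mem_right _ _ (Ideal.mul_mem_left _ _ ((IsLocalRing.mem_maximalIdeal _).2 (h i)))
  rw [hg] at hmem
  exact (IsLocalRing.mem_maximalIdeal _).1 hmem isUnit_one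

lemma exists_corner_eq_one {a : R} {r c : Fin (n + 1) → R}
    {M : Matrix (Fin (n + 1)) (Fin (n + 1)) R} (hg : (bordered a r c M).det = 1) :
    ∃ p q : Fin (n + 1) → R, a + q ⬝ᵥ (c - a • p) = 1 := by
  obtain ⟨p, i, hp⟩ : ∃ (p : Fin (n + 1) → R) (i : Fin (n + 1)), IsUnit ((c - a • p) i) := by
    obtain ⟨i, hi⟩ := exists_isUnit_col_zero hg
    cases i using Fin.cases with
    | zero =>
      obtain ⟨b, hb⟩ := hi.exists_right_inv
      refine ⟨fun i => b * (c i - 1), 0, ?_⟩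
      rw [bordered_zero_zero] at hb
      simp [← mul_assoc, hb]
    | succ i => exact ⟨0, i, by simpa using hi⟩
  obtain ⟨b, hb⟩ := hp.exists_left_inv
  refine ⟨p, Pi.single i ((1 - a) * b), ?_⟩
  rw [single_dotProduct, mul_assoc, hb]
  ring

theorem exists_eq_lower_mul_upper_mul_lower_mul_upper (g : Matrix (Fin n) (Fin n) R)
    (hg : g.det = 1) :
    ∃ l₁ u₁ l₂ u₂ : Matrix (Fin n) (Fin n) R, IsLowerUnitriangular l₁ ∧
      IsUpperUnitriangular u₁ ∧ IsLowerUnitriangular l₂ ∧ IsUpperUnitriangular u₂ ∧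
      g = l₁ * u₁ * l₂ * u₂ := by
  induction n with
  | zero =>
    exact ⟨1, 1, 1, 1, isLowerUnitriangular_one, isUpperUnitriangular_one,
      isLowerUnitriangular_one, isUpperUnitriangular_one, Subsingleton.elim _ _⟩
  | succ n ih =>
    cases n with
    | zero =>
      refine ⟨1, 1, 1, 1, isLowerUnitriangular_one, isUpperUnitriangular_one,
        isLowerUnitriangular_one, isUpperUnitriangular_one, ?_⟩
      rw [det_fin_one] at hg
      ext i j
      simp [Fin.fin_one_eq_zero i, Fin.fin_one_eq_zero j, hg]
    | succ n =>
      obtain ⟨a, r, c, M, rfl⟩ := exists_eq_bordered g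
      obtain ⟨p, q, hpq⟩ := exists_corner_eq_one hg
      obtain ⟨z, s, M', hM'⟩ := bordered_eq_mul_of_corner (r := r) (M := M) hpq
      have hdet : M'.det = 1 := by
        rw [hM', det_mul, det_mul, det_mul,
          (isLowerUnitriangular_bordered isLowerUnitriangular_one p).det_eq_one,
          (isUpperUnitriangular_bordered isUpperUnitriangular_one (-q)).det_eq_one,
          (isLowerUnitriangular_bordered isLowerUnitriangular_one z).det_eq_one,
          det_bordered_zero_col] at hg
        simpa using hg
      obtain ⟨l₁, u₁, l₂, u₂, hl₁, hu₁, hl₂, hu₂, rfl⟩ := ih M' hdet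
      rw [bordered_unipotent_mul_eq (by rw [det_mul, hl₁.det_eq_one, hu₁.det_eq_one, one_mul])]
        at hM'
      exact ⟨_, _, _, _, isLowerUnitriangular_bordered hl₁ _, isUpperUnitriangular_bordered hu₁ _,
        isLowerUnitriangular_bordered hl₂ _, isUpperUnitriangular_bordered hu₂ _, hM'⟩

end IsLocalRing

/-- Let `R` be a commutative local ring and `n ≥ 2`. Then every
`g ∈ SL(n, R)` can be written as `g = u₁v₁u₂v₂u₃v₃u₄v₄` with each `uᵢ` upper unitriangular
and each `vᵢ` lower unitriangular (all in `SL(n, R)`). -/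
theorem localRing_SL_eq_prod_four_unitriangular_pairs
    {R : Type*} [CommRing R] [IsLocalRing R] {n : ℕ} (hn : 2 ≤ n)
    (g : Matrix.SpecialLinearGroup (Fin n) R) :
    ∃ u v : Fin 4 → Matrix.SpecialLinearGroup (Fin n) R,
      (∀ k, IsUpperUnitriangular ((u k) : Matrix (Fin n) (Fin n) R)) ∧
      (∀ k, IsLowerUnitriangular ((v k) : Matrix (Fin n) (Fin n) R)) ∧
      g = u 0 * v 0 * u 1 * v 1 * u 2 * v 2 * u 3 * v 3 := by
  obtain ⟨l₁, u₁, l₂, u₂, hl₁, hu₁, hl₂, hu₂, h⟩ :=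
    exists_eq_lower_mul_upper_mul_lower_mul_upper (g : Matrix (Fin n) (Fin n) R) g.det_coe
  refine ⟨![1, ⟨u₁, hu₁.det_eq_one⟩, ⟨u₂, hu₂.det_eq_one⟩, 1],
    ![⟨l₁, hl₁.det_eq_one⟩, ⟨l₂, hl₂.det_eq_one⟩, 1, 1], ?_, ?_, ?_⟩
  · intro k
    fin_cases k <;> simp [hu₁, hu₂, isUpperUnitriangular_one]
  · intro k
    fin_cases k <;> simp [hl₁, hl₂, isLowerUnitriangular_one]
  · apply Subtype.ext
    change (g : Matrix (Fin n) (Fin n) R) = 1 * l₁ * u₁ * l₂ * u₂ * 1 * 1 * 1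
    simp [h]
end

section
/- Let n ≥ 2, let (Rᵢ)_{i ∈ I} be a family of commutative rings, and suppose there is an integer N such that for every i ∈ I, every element of SL(n, Rᵢ) is a product of at most N elementary transvections. Set R = ∏_{i ∈ I} Rᵢ. Then every element of SL(n, R) is a product of at most N·n(n−1) elementary transvections eᵢⱼ(t) with t ∈ R. -/
open Matrix in
/-- Ring homomorphisms send elementary transvections to elementary transvections. -/
theorem map_elemTransvection {n : ℕ} {R S : Type*} [CommRing R] [CommRing S] (f : R →+* S)
    (i j : Fin n) (hij : i ≠ j) (t : R) :
    SpecialLinearGroup.map f (elemTransvection i j hij t) = elemTransvection i j hij (f t) := by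
  refine Subtype.ext ?_
  change f.mapMatrix (transvection i j t) = transvection i j (f t)
  simp [transvection, map_add, Matrix.map_single]

theorem elemTransvection_zero {n : ℕ} {R : Type*} [CommRing R] (i j : Fin n) (hij : i ≠ j) :
    elemTransvection i j hij (0 : R) = 1 :=
  Subtype.ext (Matrix.transvection_zero i j)

/-- Elements of `SL(n, ∏ i, R i)` with equal components are equal. -/
theorem specialLinearGroup_pi_ext {I : Type*} {R : I → Type*} [∀ i, CommRing (R i)] {n : ℕ}
    {g g' : Matrix.SpecialLinearGroup (Fin n) (∀ i, R i)}
    (h : ∀ i, Matrix.SpecialLinearGroup.map (Pi.evalRingHom R i) g =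
      Matrix.SpecialLinearGroup.map (Pi.evalRingHom R i) g') : g = g' := by
  ext a b i
  exact congrArg (fun m : Matrix.SpecialLinearGroup (Fin n) (R i) => m.1 a b) (h i)

theorem IsProductOfElemTransvections.mul {n : ℕ} {R : Type*} [CommRing R]
    {g g' : Matrix.SpecialLinearGroup (Fin n) R} {N N' : ℕ}
    (h : IsProductOfElemTransvections g N) (h' : IsProductOfElemTransvections g' N') :
    IsProductOfElemTransvections (g * g') (N + N') := by
  obtain ⟨L, hL, hmem, rfl⟩ := h
  obtain ⟨L', hL', hmem', rfl⟩ := h'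
  refine ⟨L ++ L', by simp; omega, fun x hx => ?_, by simp⟩
  rcases List.mem_append.1 hx with hx | hx
  exacts [hmem x hx, hmem' x hx]

/-- A positive number of elementary transvections can be peeled off one at a time from the left. -/
theorem IsProductOfElemTransvections.exists_eq_mul {n : ℕ} (hn : 2 ≤ n) {R : Type*} [CommRing R]
    {g : Matrix.SpecialLinearGroup (Fin n) R} {N : ℕ}
    (h : IsProductOfElemTransvections g (N + 1)) :
    ∃ (p : {p : Fin n × Fin n // p.1 ≠ p.2}) (t : R) (g' : Matrix.SpecialLinearGroup (Fin n) R),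
      IsProductOfElemTransvections g' N ∧ g = elemTransvection p.1.1 p.1.2 p.2 t * g' := by
  obtain ⟨L, hL, hmem, rfl⟩ := h
  cases L with
  | nil =>
    refine ⟨⟨(⟨0, by omega⟩, ⟨1, by omega⟩), by simp⟩, 0, 1, ⟨[], by simp⟩, ?_⟩
    simp [elemTransvection_zero]
  | cons x L =>
    obtain ⟨i, j, hij, t, rfl⟩ := hmem x (by simp)
    exact ⟨⟨(i, j), hij⟩, t, L.prod, ⟨L, by simpa using hL,
      fun y hy => hmem y (List.mem_cons_of_mem _ hy), rfl⟩, by simp⟩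

/-- A product over a list without repetition reduces to its only nontrivial factor. -/
theorem prod_map_eq_of_nodup_of_unique {ι M : Type*} [Monoid M] {l : List ι} (hl : l.Nodup)
    {f : ι → M} {a : ι} (ha : a ∈ l) (h : ∀ b, b ≠ a → b ∈ l → f b = 1) :
    (l.map f).prod = f a := by
  classical
  rw [List.prod_map_eq_pow_single a f h, List.count_eq_one_of_mem hl ha, pow_one]

theorem card_offDiag_subtype (n : ℕ) :
    Fintype.card {p : Fin n × Fin n // p.1 ≠ p.2} = n * (n - 1) := by
  rw [Fintype.card_of_subtype (Finset.univ : Finset (Fin n)).offDiag (by simp),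
    Finset.offDiag_card]
  simp [Nat.mul_sub]

/-- An element of `SL(n, ∏ i, R i)` all of whose components are elementary transvections
(in positions depending on the component) is a product of `n * (n - 1)` elementary
transvections, one for each position. -/
theorem exists_isProductOfElemTransvections_map_eq {I : Type*} (R : I → Type*)
    [∀ i, CommRing (R i)] {n : ℕ} (p : I → {p : Fin n × Fin n // p.1 ≠ p.2}) (t : ∀ i, R i) :
    ∃ y : Matrix.SpecialLinearGroup (Fin n) (∀ i, R i),
      IsProductOfElemTransvections y (n * (n - 1)) ∧
      ∀ i, Matrix.SpecialLinearGroup.map (Pi.evalRingHom R i) y =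
        elemTransvection (p i).1.1 (p i).1.2 (p i).2 (t i) := by
  classical
  let f (q : {p : Fin n × Fin n // p.1 ≠ p.2}) : Matrix.SpecialLinearGroup (Fin n) (∀ i, R i) :=
    elemTransvection q.1.1 q.1.2 q.2 fun i => if q = p i then t i else 0
  refine ⟨(Finset.univ.toList.map f).prod, ⟨_, ?_, ?_, rfl⟩, fun i => ?_⟩
  · simp only [List.length_map, Finset.length_toList, Finset.card_univ, card_offDiag_subtype,
      le_refl]
  · intro x hx
    obtain ⟨q, -, rfl⟩ := List.mem_map.1 hx
    exact ⟨_, _, q.2, _, rfl⟩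
  · rw [map_list_prod, List.map_map,
      prod_map_eq_of_nodup_of_unique (Finset.nodup_toList _) (a := p i) (by simp)]
    · simp [f, map_elemTransvection]
    · intro q hq _
      simp [f, map_elemTransvection, hq, elemTransvection_zero]

/-- If every component of `g` is a product of at most `N` elementary transvections, then `g` is
a product of at most `N * (n * (n - 1))` elementary transvections. -/
theorem isProductOfElemTransvections_of_map {I : Type*} (R : I → Type*) [∀ i, CommRing (R i)]
    {n : ℕ} (hn : 2 ≤ n) (N : ℕ) (g : Matrix.SpecialLinearGroup (Fin n) (∀ i, R i))
    (h : ∀ i, IsProductOfElemTransvections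
      (Matrix.SpecialLinearGroup.map (Pi.evalRingHom R i) g) N) :
    IsProductOfElemTransvections g (N * (n * (n - 1))) := by
  induction N generalizing g with
  | zero =>
    refine ⟨[], by simp, by simp, specialLinearGroup_pi_ext fun i => ?_⟩
    obtain ⟨L, hL, -, hg⟩ := h i
    rw [← hg, List.eq_nil_of_length_eq_zero (Nat.le_zero.1 hL)]
    simp
  | succ N ih =>
    choose p t g' hg' hg using fun i => (h i).exists_eq_mul hn
    obtain ⟨y, hy, hyt⟩ := exists_isProductOfElemTransvections_map_eq R p t
    have hrest := ih (y⁻¹ * g) fun i => by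
      rw [map_mul, map_inv, hyt, hg, inv_mul_cancel_left]
      exact hg' i
    have hmul := hy.mul hrest
    rwa [mul_inv_cancel_left, add_comm, ← Nat.succ_mul] at hmul

/-- Let `n ≥ 2` and `(R i)` a family of commutative rings such that for
some `N`, every element of every `SL(n, R i)` is a product of at most `N` elementary
transvections. Then every element of `SL(n, ∏ i, R i)` is a product of at most
`N * (n * (n - 1))` elementary transvections. -/
theorem pi_isProductOfElemTransvections
    {I : Type*} (R : I → Type*) [∀ i, CommRing (R i)] {n : ℕ} (hn : 2 ≤ n) (N : ℕ)
    (h : ∀ i, ∀ g : Matrix.SpecialLinearGroup (Fin n) (R i),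
      IsProductOfElemTransvections g N) :
    ∀ g : Matrix.SpecialLinearGroup (Fin n) (∀ i, R i),
      IsProductOfElemTransvections g (N * (n * (n - 1))) := by
  exact fun g => isProductOfElemTransvections_of_map R hn N g fun i => h i _
end
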